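/- arXiv:2308.14299 — 14 statements merged into one kernel-verified Lean document; each statement's English description precedes it below -/
import Mathlib

section
/- For all R_A, R_B > 0 there is a unique P > 0 with π_P(P, R_B) = π₀(R_A, R_B), denoted P^eq(R_A,R_B), and the effectiveness ratio E(R_A,R_B) := P^eq(R_A,R_B)/R_A satisfies: E(R_A,R_B) = 2 if R_A ≥ R_B, and E(R_A,R_B) = 2R_B²/(R_A(2R_B − R_A)) if R_A < R_B. -/
/-- SPE payoff to player A with real-time budget `RA` and no pre-allocated
resources, against opponent real-time budget `RB`. -/
noncomputable def pi0 (RA RB : ℝ) : ℝ :=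
  if RA < RB then RA / (2 * RB) else 1 - RB / (2 * RA)

/-- SPE payoff to player A with only pre-allocated resources `P` and no
real-time resources, against opponent real-time budget `RB`. -/
noncomputable def piP (P RB : ℝ) : ℝ :=
  if RB ≤ P then 1 - RB / P else 0

/-- The payoff from pre-allocated resources takes each value of `(0, 1)` exactly once. -/
theorem piP_eq_iff {P RB v : ℝ} (hRB : 0 < RB) (hv0 : 0 < v) (hv1 : v < 1) :
    piP P RB = v ↔ P = RB / (1 - v) := by
  have hv : 0 < 1 - v := sub_pos.2 hv1
  unfold piP
  constructor
  · intro h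
    split_ifs at h with hP
    · have hP0 : P ≠ 0 := (hRB.trans_le hP).ne'
      rw [← h, sub_sub_cancel, div_div_cancel₀ hRB.ne']
    · exact absurd h hv0.ne
  · rintro rfl
    rw [if_pos (by rw [le_div_iff₀ hv]; nlinarith), div_div_cancel₀ hRB.ne', sub_sub_cancel]

theorem pi0_pos {RA RB : ℝ} (hRA : 0 < RA) (hRB : 0 < RB) : 0 < pi0 RA RB := by
  unfold pi0
  split_ifs with h
  · positivity
  · rw [sub_pos, div_lt_one (by positivity)]
    linarith

theorem pi0_lt_one {RA RB : ℝ} (hRA : 0 < RA) (hRB : 0 < RB) : pi0 RA RB < 1 := by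
  unfold pi0
  split_ifs with h
  · rw [div_lt_one (by positivity)]
    linarith
  · exact sub_lt_self 1 (by positivity)

theorem effectiveness_ratio_characterization (RA RB : ℝ) (hRA : 0 < RA) (hRB : 0 < RB) :
    (∃! P : ℝ, 0 < P ∧ piP P RB = pi0 RA RB) ∧
    ∀ P : ℝ, 0 < P → piP P RB = pi0 RA RB →
      P / RA = if RB ≤ RA then 2 else 2 * RB ^ 2 / (RA * (2 * RB - RA)) := by
  have h0 := pi0_pos hRA hRB
  have h1 := pi0_lt_one hRA hRB
  simp only [piP_eq_iff hRB h0 h1]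
  refine ⟨⟨RB / (1 - pi0 RA RB), ⟨div_pos hRB (sub_pos.2 h1), rfl⟩, fun P hP => hP.2⟩, ?_⟩
  rintro P - rfl
  unfold pi0
  rcases lt_or_ge RA RB with h | h
  · have hne : 2 * RB - RA ≠ 0 := by linarith
    rw [if_pos h, if_neg h.not_ge, one_sub_div (by positivity)]
    field_simp
  · rw [if_neg h.not_gt, if_pos h]
    rw [sub_sub_cancel, div_div_cancel₀ hRB.ne', mul_div_cancel_right₀ _ hRA.ne']
end

section
/- For every R_B > 0 and Π ∈ (0,1), the level-curve function R_Π is continuous on [0, R_B/(1−Π)], strictly decreasing on [0, R_B/(1−Π)], convex on [0, R_B/(1−Π)], and satisfies R_Π(R_B/(1−Π)) = 0; moreover R_Π(0) = 2ΠR_B if Π < 1/2 and R_Π(0) = R_B/(2(1−Π)) if Π ≥ 1/2. -/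
/-- The level-curve function `R_Π(P)`: the amount of real-time resources player A
needs, together with `P` pre-allocated resources, to achieve SPE payoff `Pi`
against opponent budget `RB`. -/
noncomputable def levelCurve (RB Pi P : ℝ) : ℝ :=
  if Pi < 1 / 2 ∧ P < (1 - 2 * Pi) * RB / (1 - Pi) then
    2 * Pi * (RB - P)
  else
    (RB - (1 - Pi) * P) ^ 2 / (2 * RB * (1 - Pi))

/-- On `P ≥ 0` the level curve is its tangent line at the breakpoint plus a truncated square. -/
lemma levelCurve_eq_add_sq_max {RB Pi P : ℝ} (hRB : 0 < RB) (hPi : Pi < 1) (hP : 0 ≤ P) :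
    levelCurve RB Pi P = 2 * Pi * (RB - P) +
      (1 - Pi) / (2 * RB) * (max (P - (1 - 2 * Pi) * RB / (1 - Pi)) 0) ^ 2 := by
  have h1 : 0 < 1 - Pi := sub_pos.mpr hPi
  unfold levelCurve
  split_ifs with h
  · rw [max_eq_right (by linarith [h.2])]
    ring
  · have ht : (1 - 2 * Pi) * RB / (1 - Pi) ≤ P := by
      by_cases hlt : Pi < 1 / 2
      · exact not_lt.mp fun h' => h ⟨hlt, h'⟩
      · refine le_trans (div_nonpos_of_nonpos_of_nonneg ?_ h1.le) hP
        exact mul_nonpos_of_nonpos_of_nonneg (by linarith) hRB.le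
    rw [max_eq_left (by linarith)]
    field_simp
    ring

lemma continuousOn_levelCurve {RB Pi : ℝ} (hRB : 0 < RB) (hPi : Pi < 1) :
    ContinuousOn (levelCurve RB Pi) (Set.Ici 0) := by
  refine ContinuousOn.congr (Continuous.continuousOn ?_)
    fun P hP => levelCurve_eq_add_sq_max hRB hPi hP
  fun_prop

lemma convexOn_levelCurve {RB Pi : ℝ} (hRB : 0 < RB) (hPi : Pi < 1) :
    ConvexOn ℝ (Set.Ici 0) (levelCurve RB Pi) := by
  have hc : 0 ≤ (1 - Pi) / (2 * RB) := div_nonneg (sub_nonneg.mpr hPi.le) (by positivity)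
  have hmax : ConvexOn ℝ (Set.Ici (0 : ℝ))
      fun P => max (P - (1 - 2 * Pi) * RB / (1 - Pi)) 0 :=
    ((convexOn_id (convex_Ici 0)).sub (concaveOn_const _ (convex_Ici 0))).sup
      (convexOn_const 0 (convex_Ici 0))
  have hlin : ConvexOn ℝ (Set.Ici (0 : ℝ)) fun P => 2 * Pi * (RB - P) := by
    refine ⟨convex_Ici 0, fun x _ y _ a b _ _ hab => le_of_eq ?_⟩
    simp only [smul_eq_mul]
    linear_combination (-2 * Pi * RB) * hab
  have hsq := (hmax.pow (fun _ _ => le_max_right _ _) 2).smul hc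
  exact (hlin.add hsq).congr fun P hP => (levelCurve_eq_add_sq_max hRB hPi hP).symm

lemma strictAntiOn_levelCurve {RB Pi : ℝ} (hRB : 0 < RB) (hPi0 : 0 < Pi) (hPi1 : Pi < 1) :
    StrictAntiOn (levelCurve RB Pi) (Set.Icc 0 (RB / (1 - Pi))) := by
  intro x hx y hy hxy
  have h1 : 0 < 1 - Pi := sub_pos.mpr hPi1
  rw [levelCurve_eq_add_sq_max hRB hPi1 hx.1, levelCurve_eq_add_sq_max hRB hPi1 hy.1]
  set t := (1 - 2 * Pi) * RB / (1 - Pi) with ht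
  set c := (1 - Pi) / (2 * RB) with hc
  have hc0 : 0 < c := by positivity
  have hend : c * (RB / (1 - Pi) - t) = Pi := by
    rw [hc, ht]
    field_simp
    ring
  have hv : c * max (y - t) 0 ≤ Pi := by
    rw [mul_max_of_nonneg _ _ hc0.le, mul_zero, max_le_iff]
    refine ⟨?_, hPi0.le⟩
    rw [← hend]
    exact mul_le_mul_of_nonneg_left (by linarith [hy.2]) hc0.le
  have huv : max (x - t) 0 ≤ max (y - t) 0 := max_le_max_right 0 (by linarith)
  have hdiff : max (y - t) 0 - max (x - t) 0 ≤ y - x := by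
    rw [sub_le_iff_le_add, max_le_iff]
    constructor <;> linarith [le_max_left (x - t) 0, le_max_right (x - t) 0]
  generalize max (y - t) 0 = v at *
  generalize max (x - t) 0 = u at *
  rcases huv.eq_or_lt with rfl | hlt
  · have := mul_pos hPi0 (sub_pos.mpr hxy)
    linarith
  · have hcu : c * u < c * v := mul_lt_mul_of_pos_left hlt hc0
    have hslope : c * (u + v) * (v - u) < 2 * Pi * (v - u) :=
      mul_lt_mul_of_pos_right (by linarith) (sub_pos.mpr hlt)
    have hlin : 2 * Pi * (v - u) ≤ 2 * Pi * (y - x) :=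
      mul_le_mul_of_nonneg_left hdiff (by linarith)
    linarith

theorem level_curve_properties (RB Pi : ℝ) (hRB : 0 < RB) (hPi : Pi ∈ Set.Ioo (0 : ℝ) 1) :
    ContinuousOn (levelCurve RB Pi) (Set.Icc 0 (RB / (1 - Pi))) ∧
    StrictAntiOn (levelCurve RB Pi) (Set.Icc 0 (RB / (1 - Pi))) ∧
    ConvexOn ℝ (Set.Icc 0 (RB / (1 - Pi))) (levelCurve RB Pi) ∧
    levelCurve RB Pi (RB / (1 - Pi)) = 0 ∧
    (Pi < 1 / 2 → levelCurve RB Pi 0 = 2 * Pi * RB) ∧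
    (1 / 2 ≤ Pi → levelCurve RB Pi 0 = RB / (2 * (1 - Pi))) := by
  obtain ⟨h0, hlt1⟩ := hPi
  have h1 : 0 < 1 - Pi := sub_pos.mpr hlt1
  refine ⟨(continuousOn_levelCurve hRB hlt1).mono Set.Icc_subset_Ici_self,
    strictAntiOn_levelCurve hRB h0 hlt1,
    (convexOn_levelCurve hRB hlt1).subset Set.Icc_subset_Ici_self (convex_Icc _ _),
    ?_, fun h => ?_, fun h => ?_⟩
  · have hle : (1 - 2 * Pi) * RB / (1 - Pi) ≤ RB / (1 - Pi) :=
      div_le_div_of_nonneg_right (by linarith [mul_pos h0 hRB]) h1.le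
    rw [levelCurve, if_neg fun h => h.2.not_ge hle, mul_div_cancel₀ _ h1.ne']
    simp
  · have hpos : 0 < (1 - 2 * Pi) * RB / (1 - Pi) :=
      div_pos (mul_pos (by linarith) hRB) h1
    rw [levelCurve, if_pos ⟨h, hpos⟩, sub_zero]
  · rw [levelCurve, if_neg fun h' => h'.1.not_ge h]
    field_simp
    ring
end

section
/- Let R_B > 0, M_A > 0 and 0 < c_A < min{1, M_A/R_B}. Set Π* = 1 − (R_B/(2M_A))·c_A(2−c_A) and P* = (2(1−c_A)/(2−c_A))·(M_A/c_A). Then Π* ∈ (0,1), P* ∈ [0, R_B/(1−Π*)], R_{Π*}(P*) = M_A − c_A·P*, and R_{Π*}(P) ≥ M_A − c_A·P for every P ∈ [0, R_B/(1−Π*)]. (Hence the budget line R_A = M_A − c_A·P is tangent from below to the level curve of level Π*, so the investment (P*, M_A − c_A P*) is optimal and yields payoff 1 − (R_B/(2M_A))·c_A(2−c_A).) -/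
/-- With `q = 1 - Π`, the line of slope `-c` tangent to the quadratic branch of the level curve
stays below the whole level curve. -/
theorem tangent_le_levelCurve {R q c : ℝ} (hR : 0 < R) (hq : 0 < q) (hqc : 2 * q ≤ 2 - c)
    (P : ℝ) : R * (c * (2 - c)) / (2 * q) - c * P ≤ levelCurve R (1 - q) P := by
  unfold levelCurve
  rw [sub_sub_cancel]
  split_ifs with h
  · obtain ⟨-, hP⟩ := h
    rw [lt_div_iff₀ hq] at hP
    rw [sub_le_iff_le_add, div_le_iff₀ (by positivity)]
    have key : 0 ≤ (2 - c - 2 * q) * (R * (2 * q - c) - P * (2 * q)) :=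
      mul_nonneg (by linarith) (by nlinarith)
    nlinarith
  · have key : (R - q * P) ^ 2 / (2 * R * q) - (R * (c * (2 - c)) / (2 * q) - c * P)
        = (R - q * P - c * R) ^ 2 / (2 * R * q) := by
      field_simp
      ring
    have : 0 ≤ (R - q * P - c * R) ^ 2 / (2 * R * q) := by positivity
    linarith

/-- The level curve meets its tangent line of slope `-c` at `P = (1 - c) R / q`,
where `q = 1 - Π`. -/
theorem levelCurve_tangent_point {R q c : ℝ} (hR : 0 < R) (hq : 0 < q) (hqc : 2 * q ≤ 2 - c) :
    levelCurve R (1 - q) ((1 - c) * R / q) = c ^ 2 * R / (2 * q) := by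
  unfold levelCurve
  rw [if_neg]
  · rw [sub_sub_cancel, mul_div_cancel₀ _ hq.ne']
    field_simp
    ring
  · rintro ⟨-, h⟩
    rw [sub_sub_cancel, div_lt_div_iff_of_pos_right hq] at h
    nlinarith

theorem optimal_investment_interior (RB MA cA : ℝ) (hRB : 0 < RB) (hMA : 0 < MA)
    (hcA : 0 < cA) (hcA' : cA < min 1 (MA / RB)) :
    (0 < 1 - RB / (2 * MA) * (cA * (2 - cA))) ∧
    (1 - RB / (2 * MA) * (cA * (2 - cA)) < 1) ∧
    (2 * (1 - cA) / (2 - cA) * (MA / cA) ∈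
      Set.Icc 0 (RB / (1 - (1 - RB / (2 * MA) * (cA * (2 - cA)))))) ∧
    levelCurve RB (1 - RB / (2 * MA) * (cA * (2 - cA))) (2 * (1 - cA) / (2 - cA) * (MA / cA))
      = MA - cA * (2 * (1 - cA) / (2 - cA) * (MA / cA)) ∧
    ∀ P ∈ Set.Icc 0 (RB / (1 - (1 - RB / (2 * MA) * (cA * (2 - cA))))),
      MA - cA * P ≤ levelCurve RB (1 - RB / (2 * MA) * (cA * (2 - cA))) P := by
  obtain ⟨h1, h2⟩ := lt_min_iff.mp hcA'
  rw [lt_div_iff₀ hRB] at h2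
  have h2c : 0 < 2 - cA := by linarith
  set q := RB / (2 * MA) * (cA * (2 - cA)) with hqdef
  have hq : 0 < q := by positivity
  have hqM : 2 * q * MA = RB * (cA * (2 - cA)) := by
    rw [hqdef]
    field_simp
  have hqc : 2 * q < 2 - cA := by
    refine lt_of_mul_lt_mul_right ?_ hMA.le
    nlinarith
  have hM : MA = RB * (cA * (2 - cA)) / (2 * q) := by
    rw [eq_div_iff (by positivity)]
    linarith
  have hP : 2 * (1 - cA) / (2 - cA) * (MA / cA) = (1 - cA) * RB / q := by
    rw [hM]
    field_simp
  rw [hP, sub_sub_cancel]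
  refine ⟨by linarith, by linarith, ⟨?_, ?_⟩, ?_, fun P _ => ?_⟩
  · have : 0 < 1 - cA := by linarith
    positivity
  · gcongr
    nlinarith
  · rw [levelCurve_tangent_point hRB hq hqc.le, hM]
    field_simp
    ring
  · have := tangent_le_levelCurve hRB hq hqc.le P
    rwa [← hM] at this
end

section
/- Let R_B > 0, M_A ≥ R_B and c_A ≥ 1. Set Π = 1 − R_B/(2M_A), so Π ∈ [1/2, 1). Then R_Π(0) = M_A and R_Π(P) ≥ M_A − c_A·P for every P ∈ [0, R_B/(1−Π)]. (Hence the investment (0, M_A), i.e. purchasing only real-time resources, is optimal and yields payoff 1 − R_B/(2M_A).) -/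
theorem div_two_mul_le_half {a b : ℝ} (ha : 0 < a) (hab : a ≤ b) : a / (2 * b) ≤ 1 / 2 := by
  rw [div_le_div_iff₀ (by linarith) two_pos]
  linarith

/-- Along the level curve of payoff `1 - RB / (2 * MA)`, the required real-time resources
are an explicit quadratic in the pre-allocated resources. -/
theorem levelCurve_one_sub_div {RB MA : ℝ} (hRB : 0 < RB) (hMA : RB ≤ MA) (P : ℝ) :
    levelCurve RB (1 - RB / (2 * MA)) P = MA - P + P ^ 2 / (4 * MA) := by
  have hM : 0 < MA := hRB.trans_le hMA
  have hq := div_two_mul_le_half hRB hMA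
  rw [levelCurve, if_neg (fun h => by linarith [h.1]), sub_sub_cancel]
  field_simp
  ring

theorem optimal_investment_realtime_only_rich (RB MA cA : ℝ) (hRB : 0 < RB)
    (hMA : RB ≤ MA) (hcA : 1 ≤ cA) :
    (1 - RB / (2 * MA) ∈ Set.Ico (1 / 2 : ℝ) 1) ∧
    levelCurve RB (1 - RB / (2 * MA)) 0 = MA ∧
    ∀ P ∈ Set.Icc 0 (RB / (1 - (1 - RB / (2 * MA)))),
      MA - cA * P ≤ levelCurve RB (1 - RB / (2 * MA)) P := by
  have hM : 0 < MA := hRB.trans_le hMA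
  refine ⟨⟨?_, ?_⟩, ?_, fun P hP => ?_⟩
  · linarith [div_two_mul_le_half hRB hMA]
  · have hq : 0 < RB / (2 * MA) := by positivity
    linarith
  · simp [levelCurve_one_sub_div hRB hMA]
  · rw [levelCurve_one_sub_div hRB hMA]
    have hcP : P ≤ cA * P := le_mul_of_one_le_left hP.1 hcA
    have hsq : 0 ≤ P ^ 2 / (4 * MA) := by positivity
    linarith
end

section
/- Let R_B > 0, 0 < M_A < R_B and c_A ≥ M_A/R_B. Set Π = M_A/(2R_B), so Π ∈ (0, 1/2). Then R_Π(0) = M_A and R_Π(P) ≥ M_A − c_A·P for every P ∈ [0, R_B/(1−Π)]. (Hence the investment (0, M_A), i.e. purchasing only real-time resources, is optimal and yields payoff M_A/(2R_B).) -/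
/-- The level curve lies above its linear branch extended to all `P`, which is tangent
to the quadratic branch. -/
theorem linear_le_levelCurve {RB Pi : ℝ} (hRB : 0 < RB) (hPi : Pi < 1) (P : ℝ) :
    2 * Pi * (RB - P) ≤ levelCurve RB Pi P := by
  unfold levelCurve
  split_ifs
  · exact le_rfl
  · have hq : 0 < 1 - Pi := sub_pos.2 hPi
    rw [le_div_iff₀ (by positivity)]
    linarith [sq_nonneg ((1 - Pi) * P - (1 - 2 * Pi) * RB)]

/-- Below performance level `1 / 2`, using no pre-allocated resources requires `2 * Pi * RB`
real-time resources. -/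
theorem levelCurve_zero {RB Pi : ℝ} (hRB : 0 < RB) (hPi : Pi < 1 / 2) :
    levelCurve RB Pi 0 = 2 * Pi * RB := by
  have hpos : 0 < (1 - 2 * Pi) * RB / (1 - Pi) :=
    div_pos (mul_pos (by linarith) hRB) (by linarith)
  rw [levelCurve, if_pos ⟨hPi, hpos⟩, sub_zero]

theorem optimal_investment_realtime_only_poor (RB MA cA : ℝ) (hRB : 0 < RB)
    (hMA : 0 < MA) (hMA' : MA < RB) (hcA : MA / RB ≤ cA) :
    (MA / (2 * RB) ∈ Set.Ioo (0 : ℝ) (1 / 2)) ∧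
    levelCurve RB (MA / (2 * RB)) 0 = MA ∧
    ∀ P ∈ Set.Icc 0 (RB / (1 - MA / (2 * RB))),
      MA - cA * P ≤ levelCurve RB (MA / (2 * RB)) P := by
  have hlt : MA / (2 * RB) < 1 / 2 := by
    rw [div_lt_iff₀ (by positivity)]
    linarith
  refine ⟨⟨by positivity, hlt⟩, ?_, fun P hP => ?_⟩
  · rw [levelCurve_zero hRB hlt]
    field_simp
  · calc MA - cA * P ≤ MA - MA / RB * P :=
          sub_le_sub_left (mul_le_mul_of_nonneg_right hcA hP.1) MA
      _ = 2 * (MA / (2 * RB)) * (RB - P) := by field_simp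
      _ ≤ levelCurve RB (MA / (2 * RB)) P := linear_le_levelCurve hRB (by linarith) P
end

section
/- Let R_A > 0, p_A > 0, c_B ∈ (0,1) and M_B > 0 with M_B/c_B ≤ R_A + p_A. Define f_A(p_B) = R_A + √(R_A(R_A + 2(p_A − p_B))) and u(p_B) = ((M_B − c_B·p_B)/(2R_A))·(f_A(p_B)/(p_A − p_B + f_A(p_B)))². Then u is nonincreasing on the interval [0, min{p_A, M_B/c_B}]. -/
/-- With `s = √(R (R + 2 x))`, the ratio `(R + s) / (x + (R + s))` equals `2 R / (R + s)`. -/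
theorem add_sqrt_div_add_add_sqrt {R x : ℝ} (hR : 0 < R) (hx : 0 ≤ x) :
    (R + √(R * (R + 2 * x))) / (x + (R + √(R * (R + 2 * x)))) =
      2 * R / (R + √(R * (R + 2 * x))) := by
  have hs := Real.sq_sqrt (show 0 ≤ R * (R + 2 * x) by positivity)
  have hs0 := Real.sqrt_nonneg (R * (R + 2 * x))
  rw [div_eq_div_iff (by positivity) (by positivity)]
  linear_combination hs

/-- If `L ≤ c R`, then `(L + c x) / (R + s) ^ 2` is monotone in `s ≥ R`, where `x` and `s` are
related by `s ^ 2 = R (R + 2 x)`. -/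
theorem add_mul_div_add_sq_le {R L c x y s t : ℝ} (hR : 0 < R) (hc : 0 ≤ c) (hL : L ≤ c * R)
    (hs : s ^ 2 = R * (R + 2 * x)) (ht : t ^ 2 = R * (R + 2 * y)) (hRt : R ≤ t) (hts : t ≤ s) :
    (L + c * y) / (R + t) ^ 2 ≤ (L + c * x) / (R + s) ^ 2 := by
  have hRs : R ≤ s := hRt.trans hts
  have ht0 : 0 < R + t := by linarith
  have hs0 : 0 < R + s := by linarith
  rw [div_le_div_iff₀ (by positivity) (by positivity)]
  have hst : R * R ≤ s * t := mul_le_mul hRs hRt hR.le (hR.le.trans hRs)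
  have hbracket : L * (2 * R + s + t) ≤ c * ((R + s) * (R + t)) := calc
    L * (2 * R + s + t) ≤ c * R * (2 * R + s + t) := mul_le_mul_of_nonneg_right hL (by linarith)
    _ = c * (R * (2 * R + s + t)) := by ring
    _ ≤ c * ((R + s) * (R + t)) := mul_le_mul_of_nonneg_left (by linarith) hc
  have hprod := mul_nonneg hR.le (mul_nonneg (sub_nonneg.2 hts) (sub_nonneg.2 hbracket))
  refine le_of_mul_le_mul_left ?_ (show 0 < 2 * R by positivity)
  linear_combination 2 * hprod - c * (R + s) ^ 2 * ht + c * (R + t) ^ 2 * hs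

theorem uB1A_antitone (RA pA cB MB : ℝ) (hRA : 0 < RA) (hpA : 0 < pA)
    (hcB : cB ∈ Set.Ioo (0 : ℝ) 1) (hMB : 0 < MB) (h : MB / cB ≤ RA + pA) :
    AntitoneOn (fun pB : ℝ =>
        (MB - cB * pB) / (2 * RA) *
          ((RA + Real.sqrt (RA * (RA + 2 * (pA - pB)))) /
            (pA - pB + (RA + Real.sqrt (RA * (RA + 2 * (pA - pB)))))) ^ 2)
      (Set.Icc 0 (min pA (MB / cB))) := by
  obtain ⟨hc0, -⟩ := hcB
  rw [div_le_iff₀ hc0] at h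
  intro p hp q hq hpq
  have hp_le : p ≤ pA := hp.2.trans (min_le_left _ _)
  have hq_le : q ≤ pA := hq.2.trans (min_le_left _ _)
  have hx : 0 ≤ pA - p := sub_nonneg.2 hp_le
  have hy : 0 ≤ pA - q := sub_nonneg.2 hq_le
  have hRt : RA ≤ √(RA * (RA + 2 * (pA - q))) := Real.le_sqrt_of_sq_le (by nlinarith)
  have hts : √(RA * (RA + 2 * (pA - q))) ≤ √(RA * (RA + 2 * (pA - p))) := by gcongr
  have key := add_mul_div_add_sq_le (L := MB - cB * pA) hRA hc0.le (by linarith)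
    (Real.sq_sqrt (by positivity)) (Real.sq_sqrt (by positivity)) hRt hts
  have hform (r : ℝ) (hr : 0 ≤ pA - r) :
      (MB - cB * r) / (2 * RA) *
          ((RA + √(RA * (RA + 2 * (pA - r)))) /
            (pA - r + (RA + √(RA * (RA + 2 * (pA - r)))))) ^ 2 =
        2 * RA *
          ((MB - cB * pA + cB * (pA - r)) / (RA + √(RA * (RA + 2 * (pA - r)))) ^ 2) := by
    rw [add_sqrt_div_add_add_sqrt hRA hr]
    have hs0 := Real.sqrt_nonneg (RA * (RA + 2 * (pA - r)))
    field_simp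
    ring
  beta_reduce
  rw [hform p hx, hform q hy]
  gcongr
end

section
/- Let R_A > 0 and p_A > 0, and define F(p) = 2(R_A + p_A − p)²/(2R_A + p_A − p). Then F is strictly decreasing on [p_A, R_A + p_A], F(p_A) = R_A, and F(R_A + p_A) = 0. Moreover, if c_B ∈ (0,1) and M_B satisfies c_B(R_A + p_A) < M_B ≤ R_A + c_B·p_A, then there exists a unique p ∈ [p_A, R_A + p_A) such that F(p) = M_B − c_B·p. -/
/-- A quadratic `a x² - b x - d` with `a, d > 0` has at most one nonnegative root. -/
lemma nonneg_root_unique {a b d x y : ℝ} (ha : 0 < a) (hd : 0 < d) (hx : 0 ≤ x) (hy : 0 ≤ y)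
    (hxr : a * x ^ 2 - b * x - d = 0) (hyr : a * y ^ 2 - b * y - d = 0) : x = y := by
  have key : (x - y) * (a * (x + y) - b) = 0 := by linear_combination hxr - hyr
  rcases mul_eq_zero.mp key with h | h
  · exact sub_eq_zero.mp h
  · have hprod : a * (x * y) + d = 0 := by linear_combination x * h - hxr
    have : 0 ≤ a * (x * y) := by positivity
    linarith

theorem F_strictAnti_and_unique_crossing (RA pA : ℝ) (hRA : 0 < RA) (hpA : 0 < pA) :
    StrictAntiOn (fun p : ℝ => 2 * (RA + pA - p) ^ 2 / (2 * RA + pA - p))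
      (Set.Icc pA (RA + pA)) ∧
    2 * (RA + pA - pA) ^ 2 / (2 * RA + pA - pA) = RA ∧
    2 * (RA + pA - (RA + pA)) ^ 2 / (2 * RA + pA - (RA + pA)) = 0 ∧
    ∀ cB MB : ℝ, cB ∈ Set.Ioo (0 : ℝ) 1 → cB * (RA + pA) < MB → MB ≤ RA + cB * pA →
      ∃! p : ℝ, p ∈ Set.Ico pA (RA + pA) ∧
        2 * (RA + pA - p) ^ 2 / (2 * RA + pA - p) = MB - cB * p := by
  refine ⟨?_, ?_, by simp, ?_⟩
  · rintro p ⟨-, hp⟩ q ⟨-, hq⟩ hpq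
    obtain ⟨x, rfl⟩ : ∃ x, p = RA + pA - x := ⟨RA + pA - p, by ring⟩
    obtain ⟨y, rfl⟩ : ∃ y, q = RA + pA - y := ⟨RA + pA - q, by ring⟩
    have hx : 0 ≤ x := by linarith
    have hy : 0 ≤ y := by linarith
    have hyx : 0 < x - y := by linarith
    have hpos : 0 < (x - y) * (RA * (x + y) + x * y) := by
      have : 0 < x + y := by linarith
      positivity
    show 2 * _ ^ 2 / _ < 2 * _ ^ 2 / _
    rw [div_lt_div_iff₀ (by linarith) (by linarith)]
    linarith
  · field_simp
    ring
  · rintro cB MB ⟨-, hc1⟩ hlow hup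
    have cross : ∀ p < RA + pA, (2 * (RA + pA - p) ^ 2 / (2 * RA + pA - p) = MB - cB * p ↔
        2 * (RA + pA - p) ^ 2 - (MB - cB * p) * (2 * RA + pA - p) = 0) := fun p hp => by
      rw [div_eq_iff (by linarith), sub_eq_zero]
    have hend : 0 < RA * (MB - cB * (RA + pA)) := mul_pos hRA (by linarith)
    have hstart : 0 ≤ RA * (RA + cB * pA - MB) := mul_nonneg hRA.le (by linarith)
    obtain ⟨p, ⟨hp1, hp2⟩, hp⟩ := intermediate_value_Icc' (a := pA) (b := RA + pA)
      (f := fun p => 2 * (RA + pA - p) ^ 2 - (MB - cB * p) * (2 * RA + pA - p))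
      (by linarith) (by fun_prop) (show (0 : ℝ) ∈ _ from ⟨by linarith, by linarith⟩)
    have hp2 : p < RA + pA := by
      refine lt_of_le_of_ne hp2 ?_
      rintro rfl
      linarith
    refine ⟨p, ⟨⟨hp1, hp2⟩, (cross p hp2).2 hp⟩, ?_⟩
    rintro q ⟨⟨-, hq2⟩, hq⟩
    have hq := (cross q hq2).1 hq
    have := nonneg_root_unique (a := 2 - cB) (b := MB - cB * (RA + pA) + cB * RA)
      (x := RA + pA - q) (y := RA + pA - p) (by linarith) hend (by linarith) (by linarith)
      (by linear_combination hq) (by linear_combination hp)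
    linarith
end

section
/- Let c_B ∈ (0,1) and 0 < p_A < M_B, and define G(p) = 2(M_B + (1−c_B)p − p_A)²/(2(M_B − c_B·p) − (p_A − p)). Then the denominator 2(M_B − c_B·p) − (p_A − p) is positive for all p ∈ [0, p_A], and G is strictly increasing on [0, p_A]. -/
theorem two_mul_sq_div_lt_two_mul_sq_div {x y a b : ℝ} (hx : 0 < x) (hxy : x < y)
    (hb : 0 ≤ b) (hba : b ≤ a) :
    2 * x ^ 2 / (2 * x + a) < 2 * y ^ 2 / (2 * y + b) := by
  have hy : 0 < y := hx.trans hxy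
  rw [div_lt_div_iff₀ (by linarith) (by linarith)]
  have h₁ : x ^ 2 * b ≤ x ^ 2 * a := by gcongr
  have h₂ : x ^ 2 * a ≤ y ^ 2 * a := by
    have := hb.trans hba
    gcongr
  have h₃ : 0 < x * y * (y - x) := mul_pos (mul_pos hx hy) (sub_pos.mpr hxy)
  linarith

theorem G_strictMono (cB MB pA : ℝ) (hcB : cB ∈ Set.Ioo (0 : ℝ) 1)
    (hpA : 0 < pA) (hMB : pA < MB) :
    (∀ p ∈ Set.Icc 0 pA, 0 < 2 * (MB - cB * p) - (pA - p)) ∧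
    StrictMonoOn
      (fun p : ℝ => 2 * (MB + (1 - cB) * p - pA) ^ 2 / (2 * (MB - cB * p) - (pA - p)))
      (Set.Icc 0 pA) := by
  have hc : 0 < 1 - cB := sub_pos.mpr hcB.2
  have hN : ∀ p ∈ Set.Icc 0 pA, 0 < MB + (1 - cB) * p - pA := fun p hp => by
    have := mul_nonneg hc.le hp.1
    linarith
  have hD (p : ℝ) : 2 * (MB - cB * p) - (pA - p) =
      2 * (MB + (1 - cB) * p - pA) + (pA - p) := by ring
  refine ⟨fun p hp => ?_, fun p hp q hq hpq => ?_⟩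
  · rw [hD]
    linarith [hN p hp, hp.2]
  · simp only [hD]
    refine two_mul_sq_div_lt_two_mul_sq_div (hN p hp) ?_ (sub_nonneg.mpr hq.2) (by linarith)
    gcongr
end

section
/- Let p_A ≥ 0, c_B ∈ (0,1), R_A > 0 and M_B > c_B·p_A. Define ℓ(p) = √(M_B − c_B·p), g(p) = √(M_B − c_B·p + 2(p − p_A)), and u(p) = 1 − (R_A/2)·((ℓ(p) + g(p))/(p − p_A + ℓ(p)(ℓ(p) + g(p))))². Set p̂ = M_B/c_B − (M_B − c_B·p_A)/(2 − c_B). Then p_A < p̂ < M_B/c_B, u is strictly increasing on (p_A, p̂), and u is strictly decreasing on (p̂, M_B/c_B); in particular p̂ is the unique maximizer of u on (p_A, M_B/c_B). -/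
/-- Along the ellipse `a * x ^ 2 + b * y ^ 2 = const`, the sum `x + y` grows as `x` decreases, as long
as `b * y ≤ a * x`. -/
lemma add_lt_add_of_ellipse {a b x₁ y₁ x₂ y₂ : ℝ} (hb : 0 < b) (hy₁ : 0 ≤ y₁)
    (hy : y₁ < y₂) (hx : x₂ < x₁) (h : a * x₁ ^ 2 + b * y₁ ^ 2 = a * x₂ ^ 2 + b * y₂ ^ 2)
    (h₁ : b * y₁ < a * x₁) (h₂ : b * y₂ ≤ a * x₂) : x₁ + y₁ < x₂ + y₂ := by
  by_contra! hle
  have hpos : 0 < b * (y₁ + y₂) := mul_pos hb (by linarith)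
  have key : a * (x₁ + x₂) * (x₁ - x₂) = b * (y₁ + y₂) * (y₂ - y₁) := by linarith
  have hlt : b * (y₁ + y₂) * (x₁ - x₂) < a * (x₁ + x₂) * (x₁ - x₂) :=
    mul_lt_mul_of_pos_right (by linarith) (by linarith)
  have hge : b * (y₁ + y₂) * (y₂ - y₁) ≤ b * (y₁ + y₂) * (x₁ - x₂) :=
    mul_le_mul_of_nonneg_left (by linarith) hpos.le
  linarith

/-- The payoff in region 1B depends on the two square roots only through their sum. -/
lemma sqrt_add_sqrt_div_eq {x t : ℝ} (hx : 0 ≤ x) (ht : 0 < t) :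
    (√x + √(x + 2 * t)) / (t + √x * (√x + √(x + 2 * t))) = 2 / (√x + √(x + 2 * t)) := by
  have hx2 : √x ^ 2 = x := Real.sq_sqrt hx
  have hg2 : √(x + 2 * t) ^ 2 = x + 2 * t := Real.sq_sqrt (by linarith)
  have hg : 0 < √(x + 2 * t) := Real.sqrt_pos.2 (by linarith)
  have hl := Real.sqrt_nonneg x
  rw [div_eq_div_iff (by positivity) (by positivity)]
  linear_combination hg2 - hx2

section

variable {pA cB MB p q : ℝ}

lemma two_sub_mul_sq_sqrt_add (hA : pA ≤ p) (hp : cB * p ≤ MB) :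
    (2 - cB) * √(MB - cB * p) ^ 2 + cB * √(MB - cB * p + 2 * (p - pA)) ^ 2 =
      2 * (MB - cB * pA) := by
  rw [Real.sq_sqrt (by linarith), Real.sq_sqrt (by linarith)]
  ring

lemma critical_mul_eq (h0 : 0 < cB) (h1 : cB < 1) :
    cB * (2 - cB) * (MB / cB - (MB - cB * pA) / (2 - cB)) =
      (2 - cB) * MB - cB * (MB - cB * pA) := by
  have : 2 - cB ≠ 0 := by linarith
  field_simp

lemma sq_mul_sqrt_sub (h0 : 0 < cB) (h1 : cB < 1) (hA : pA ≤ p) (hp : cB * p ≤ MB) :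
    ((2 - cB) * √(MB - cB * p)) ^ 2 - (cB * √(MB - cB * p + 2 * (p - pA))) ^ 2 =
      2 * (cB * (2 - cB)) * (MB / cB - (MB - cB * pA) / (2 - cB) - p) := by
  rw [mul_pow, mul_pow, Real.sq_sqrt (by linarith), Real.sq_sqrt (by linarith)]
  linear_combination (-2) * critical_mul_eq (pA := pA) (MB := MB) h0 h1

lemma cB_mul_sqrt_lt_iff (h0 : 0 < cB) (h1 : cB < 1) (hA : pA ≤ p) (hp : cB * p ≤ MB) :
    cB * √(MB - cB * p + 2 * (p - pA)) < (2 - cB) * √(MB - cB * p) ↔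
      p < MB / cB - (MB - cB * pA) / (2 - cB) := by
  have h2 : 0 < 2 - cB := by linarith
  rw [← pow_lt_pow_iff_left₀ (by positivity) (by positivity) two_ne_zero, ← sub_pos,
    sq_mul_sqrt_sub h0 h1 hA hp, mul_pos_iff_of_pos_left (by positivity), sub_pos]

lemma two_sub_mul_sqrt_lt_iff (h0 : 0 < cB) (h1 : cB < 1) (hA : pA ≤ p) (hp : cB * p ≤ MB) :
    (2 - cB) * √(MB - cB * p) < cB * √(MB - cB * p + 2 * (p - pA)) ↔
      MB / cB - (MB - cB * pA) / (2 - cB) < p := by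
  have h2 : 0 < 2 - cB := by linarith
  rw [← pow_lt_pow_iff_left₀ (by positivity) (by positivity) two_ne_zero, ← sub_neg,
    sq_mul_sqrt_sub h0 h1 hA hp, ← neg_pos, ← mul_neg, mul_pos_iff_of_pos_left (by positivity),
    neg_pos, sub_neg]

lemma sqrt_lt_sqrt_of_spending_lt (h0 : 0 < cB) (hpq : p < q) (hq : cB * q ≤ MB) :
    √(MB - cB * q) < √(MB - cB * p) :=
  Real.sqrt_lt_sqrt (by linarith) (by nlinarith)

lemma sqrt_add_lt_sqrt_add (h0 : 0 < cB) (h1 : cB < 1) (hA : pA ≤ p) (hpq : p < q)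
    (hq : cB * q ≤ MB) :
    √(MB - cB * p + 2 * (p - pA)) < √(MB - cB * q + 2 * (q - pA)) :=
  Real.sqrt_lt_sqrt (by nlinarith) (by nlinarith)

lemma sum_sqrt_lt_of_le_critical (h0 : 0 < cB) (h1 : cB < 1) (hA : pA ≤ p) (hpq : p < q)
    (hq : cB * q ≤ MB) (hc : q ≤ MB / cB - (MB - cB * pA) / (2 - cB)) :
    √(MB - cB * p) + √(MB - cB * p + 2 * (p - pA)) <
      √(MB - cB * q) + √(MB - cB * q + 2 * (q - pA)) := by
  have hp : cB * p ≤ MB := by nlinarith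
  refine add_lt_add_of_ellipse h0 (Real.sqrt_nonneg _) (sqrt_add_lt_sqrt_add h0 h1 hA hpq hq)
    (sqrt_lt_sqrt_of_spending_lt h0 hpq hq)
    ((two_sub_mul_sq_sqrt_add hA hp).trans (two_sub_mul_sq_sqrt_add (hA.trans hpq.le) hq).symm)
    ((cB_mul_sqrt_lt_iff h0 h1 hA hp).2 (hpq.trans_le hc)) (not_lt.1 fun h => ?_)
  exact hc.not_gt ((two_sub_mul_sqrt_lt_iff h0 h1 (hA.trans hpq.le) hq).1 h)

lemma sum_sqrt_lt_of_critical_le (h0 : 0 < cB) (h1 : cB < 1) (hA : pA ≤ p) (hpq : p < q)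
    (hq : cB * q ≤ MB) (hc : MB / cB - (MB - cB * pA) / (2 - cB) ≤ p) :
    √(MB - cB * q) + √(MB - cB * q + 2 * (q - pA)) <
      √(MB - cB * p) + √(MB - cB * p + 2 * (p - pA)) := by
  have hp : cB * p ≤ MB := by nlinarith
  rw [add_comm √(MB - cB * q), add_comm √(MB - cB * p)]
  refine add_lt_add_of_ellipse (a := cB) (b := 2 - cB) (by linarith) (Real.sqrt_nonneg _)
    (sqrt_lt_sqrt_of_spending_lt h0 hpq hq) (sqrt_add_lt_sqrt_add h0 h1 hA hpq hq) ?_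
    ((two_sub_mul_sqrt_lt_iff h0 h1 (hA.trans hpq.le) hq).2 (hc.trans_lt hpq))
    (not_lt.1 fun h => ?_)
  · linarith [two_sub_mul_sq_sqrt_add hA hp, two_sub_mul_sq_sqrt_add (hA.trans hpq.le) hq]
  · exact hc.not_gt ((cB_mul_sqrt_lt_iff h0 h1 hA hp).1 h)

/-- The payoff in region 1B is strictly increasing in the sum of the two square roots. -/
lemma payoff_lt_payoff {RA : ℝ} (hRA : 0 < RA) (hAp : pA < p) (hp : cB * p ≤ MB)
    (hAq : pA < q) (hq : cB * q ≤ MB)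
    (h : √(MB - cB * p) + √(MB - cB * p + 2 * (p - pA)) <
      √(MB - cB * q) + √(MB - cB * q + 2 * (q - pA))) :
    1 - RA / 2 * ((√(MB - cB * p) + √(MB - cB * p + 2 * (p - pA))) /
        (p - pA + √(MB - cB * p) * (√(MB - cB * p) + √(MB - cB * p + 2 * (p - pA))))) ^ 2 <
      1 - RA / 2 * ((√(MB - cB * q) + √(MB - cB * q + 2 * (q - pA))) /
        (q - pA + √(MB - cB * q) * (√(MB - cB * q) + √(MB - cB * q + 2 * (q - pA))))) ^ 2 := by
  rw [sqrt_add_sqrt_div_eq (by linarith) (by linarith),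
    sqrt_add_sqrt_div_eq (by linarith) (by linarith)]
  have hpos : 0 < √(MB - cB * p) + √(MB - cB * p + 2 * (p - pA)) :=
    add_pos_of_nonneg_of_pos (Real.sqrt_nonneg _) (Real.sqrt_pos.2 (by linarith))
  gcongr

end


theorem uB1B_unimodal (pA cB RA MB : ℝ) (hpA : 0 ≤ pA) (hcB : cB ∈ Set.Ioo (0 : ℝ) 1)
    (hRA : 0 < RA) (hMB : cB * pA < MB) :
    pA < MB / cB - (MB - cB * pA) / (2 - cB) ∧
    MB / cB - (MB - cB * pA) / (2 - cB) < MB / cB ∧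
    StrictMonoOn
      (fun p : ℝ => 1 - RA / 2 *
        ((Real.sqrt (MB - cB * p) + Real.sqrt (MB - cB * p + 2 * (p - pA))) /
          (p - pA + Real.sqrt (MB - cB * p) *
            (Real.sqrt (MB - cB * p) + Real.sqrt (MB - cB * p + 2 * (p - pA))))) ^ 2)
      (Set.Ioo pA (MB / cB - (MB - cB * pA) / (2 - cB))) ∧
    StrictAntiOn
      (fun p : ℝ => 1 - RA / 2 *
        ((Real.sqrt (MB - cB * p) + Real.sqrt (MB - cB * p + 2 * (p - pA))) /
          (p - pA + Real.sqrt (MB - cB * p) *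
            (Real.sqrt (MB - cB * p) + Real.sqrt (MB - cB * p + 2 * (p - pA))))) ^ 2)
      (Set.Ioo (MB / cB - (MB - cB * pA) / (2 - cB)) (MB / cB)) ∧
    ∀ p ∈ Set.Ioo pA (MB / cB), p ≠ MB / cB - (MB - cB * pA) / (2 - cB) →
      (1 - RA / 2 *
        ((Real.sqrt (MB - cB * p) + Real.sqrt (MB - cB * p + 2 * (p - pA))) /
          (p - pA + Real.sqrt (MB - cB * p) *
            (Real.sqrt (MB - cB * p) + Real.sqrt (MB - cB * p + 2 * (p - pA))))) ^ 2)
      < (1 - RA / 2 *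
        ((Real.sqrt (MB - cB * (MB / cB - (MB - cB * pA) / (2 - cB))) +
            Real.sqrt (MB - cB * (MB / cB - (MB - cB * pA) / (2 - cB)) +
              2 * ((MB / cB - (MB - cB * pA) / (2 - cB)) - pA))) /
          ((MB / cB - (MB - cB * pA) / (2 - cB)) - pA +
            Real.sqrt (MB - cB * (MB / cB - (MB - cB * pA) / (2 - cB))) *
              (Real.sqrt (MB - cB * (MB / cB - (MB - cB * pA) / (2 - cB))) +
                Real.sqrt (MB - cB * (MB / cB - (MB - cB * pA) / (2 - cB)) +
                  2 * ((MB / cB - (MB - cB * pA) / (2 - cB)) - pA))))) ^ 2) := by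
  obtain ⟨h0, h1⟩ := hcB
  have h2 : 0 < 2 - cB := by linarith
  have hD : 0 < MB - cB * pA := by linarith
  have hlow : pA < MB / cB - (MB - cB * pA) / (2 - cB) := by
    refine lt_of_mul_lt_mul_left ?_ (mul_pos h0 h2).le
    rw [critical_mul_eq h0 h1]
    nlinarith
  have hhigh : MB / cB - (MB - cB * pA) / (2 - cB) < MB / cB := sub_lt_self _ (div_pos hD h2)
  have hbudget {p : ℝ} (hp : p < MB / cB) : cB * p ≤ MB := ((lt_div_iff₀' h0).1 hp).le
  refine ⟨hlow, hhigh, ?_, ?_, ?_⟩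
  · rintro p ⟨hp, -⟩ q ⟨hq, hqc⟩ hpq
    have hqM := hqc.trans hhigh
    exact payoff_lt_payoff hRA hp (hbudget (hpq.trans hqM)) hq (hbudget hqM)
      (sum_sqrt_lt_of_le_critical h0 h1 hp.le hpq (hbudget hqM) hqc.le)
  · rintro p ⟨hcp, hpM⟩ q ⟨hcq, hqM⟩ hpq
    have hp := hlow.trans hcp
    exact payoff_lt_payoff hRA (hlow.trans hcq) (hbudget hqM) hp (hbudget hpM)
      (sum_sqrt_lt_of_critical_le h0 h1 hp.le hpq (hbudget hqM) hcp.le)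
  · rintro p ⟨hp, hpM⟩ hne
    refine payoff_lt_payoff hRA hp (hbudget hpM) hlow (hbudget hhigh) ?_
    rcases hne.lt_or_gt with hlt | hgt
    · exact sum_sqrt_lt_of_le_critical h0 h1 hp.le hlt (hbudget hhigh) le_rfl
    · exact sum_sqrt_lt_of_critical_le h0 h1 hlow.le hgt (hbudget hpM) le_rfl
end

section
/- Let p_A ≥ 0, c_B ∈ (0,1), R_A > 0 and M_B > c_B·p_A. With ℓ(p) = √(M_B − c_B·p), g(p) = √(M_B − c_B·p + 2(p − p_A)), u(p) = 1 − (R_A/2)·((ℓ(p) + g(p))/(p − p_A + ℓ(p)(ℓ(p) + g(p))))², and p̂ = M_B/c_B − (M_B − c_B·p_A)/(2 − c_B), one has the identity u(p̂) = 1 − (c_B(2 − c_B)/2)·R_A/(M_B − c_B·p_A). -/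
theorem uB1B_value_at_phat (pA cB RA MB : ℝ) (hpA : 0 ≤ pA) (hcB : cB ∈ Set.Ioo (0 : ℝ) 1)
    (hRA : 0 < RA) (hMB : cB * pA < MB) :
    (fun p : ℝ => 1 - RA / 2 *
        ((Real.sqrt (MB - cB * p) + Real.sqrt (MB - cB * p + 2 * (p - pA))) /
          (p - pA + Real.sqrt (MB - cB * p) *
            (Real.sqrt (MB - cB * p) + Real.sqrt (MB - cB * p + 2 * (p - pA))))) ^ 2)
      (MB / cB - (MB - cB * pA) / (2 - cB))
      = 1 - cB * (2 - cB) / 2 * RA / (MB - cB * pA) := by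
  obtain ⟨hc0, hc1⟩ := hcB
  have hc2 : 0 < 2 - cB := by linarith
  have hD : 0 < MB - cB * pA := by linarith
  obtain ⟨s, hs, hsq⟩ : ∃ s : ℝ, 0 < s ∧ s ^ 2 = cB * (MB - cB * pA) / (2 - cB) :=
    ⟨_, Real.sqrt_pos.2 (by positivity), Real.sq_sqrt (by positivity)⟩
  have hl : MB - cB * (MB / cB - (MB - cB * pA) / (2 - cB)) = s ^ 2 := by
    rw [hsq]
    field_simp
    ring
  have hp : MB / cB - (MB - cB * pA) / (2 - cB) - pA = s ^ 2 * (2 - 2 * cB) / cB ^ 2 := by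
    rw [hsq]
    field_simp
    ring
  have hg : s ^ 2 + 2 * (s ^ 2 * (2 - 2 * cB) / cB ^ 2) = (s * (2 - cB) / cB) ^ 2 := by
    field_simp
    ring
  have hden : s ^ 2 * (2 - 2 * cB) / cB ^ 2 + s * (s + s * (2 - cB) / cB)
      = 2 * s ^ 2 / cB ^ 2 := by
    field_simp
    ring
  have hnum : s + s * (2 - cB) / cB = 2 * s / cB := by
    field_simp
    ring
  have hD' : MB - cB * pA = s ^ 2 * (2 - cB) / cB := by
    rw [hsq]
    field_simp
  beta_reduce
  rw [hl, hp, hg, Real.sqrt_sq hs.le, Real.sqrt_sq (by positivity), hden, hnum, hD']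
  field_simp
end

section
/- Let c_A ∈ (0,1) and M_A, M_B > 0. Define, for p ∈ [0, M_A/c_A), R(p) = M_A − c_A·p, f(p) = R(p) + √(R(p)(R(p) + 2p)), and u(p) = (M_B/(2R(p)))·(f(p)/(p + f(p)))². Then u has exactly one critical point on (0, M_A/c_A), located at p̄ = (2(1−c_A)/(2−c_A))·(M_A/c_A); u is strictly decreasing on [0, p̄) and strictly increasing on (p̄, M_A/c_A). -/
/-- With `a = √r` and `b = √(r + 2p)` the equilibrium payoff simplifies to `2m / (a + b)²`. -/
lemma lottoPayoff_eq (m : ℝ) {r p : ℝ} (hr : 0 < r) (hrp : 0 < r + 2 * p) :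
    m / (2 * r) * ((r + √(r * (r + 2 * p))) / (p + (r + √(r * (r + 2 * p))))) ^ 2 =
      2 * m / (√r + √(r + 2 * p)) ^ 2 := by
  have ha : 0 < √r := Real.sqrt_pos.2 hr
  have hb : 0 < √(r + 2 * p) := Real.sqrt_pos.2 hrp
  have ha2 : √r ^ 2 = r := Real.sq_sqrt hr.le
  have hb2 : √(r + 2 * p) ^ 2 = r + 2 * p := Real.sq_sqrt hrp.le
  rw [Real.sqrt_mul hr.le]
  set a := √r
  set b := √(r + 2 * p)
  have hnum : r + a * b = a * (a + b) := by rw [← ha2]; ring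
  have hden : p + (r + a * b) = (a + b) ^ 2 / 2 := by linear_combination (-ha2 - hb2) / 2
  rw [hden, hnum, ← ha2]
  field_simp

/-- The derivative of the payoff along the budget line is a positive multiple of the signed
distance to the critical point. -/
lemma exists_pos_hasDerivAt_lottoPayoff {c M m p : ℝ} (hc : 0 < c) (hc1 : c < 1) (hm : 0 < m)
    (hr : 0 < M - c * p) (hrp : 0 < M - c * p + 2 * p) :
    ∃ K > 0, HasDerivAt (fun q : ℝ => m / (2 * (M - c * q)) *
        (((M - c * q) + √((M - c * q) * ((M - c * q) + 2 * q))) /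
          (q + ((M - c * q) + √((M - c * q) * ((M - c * q) + 2 * q))))) ^ 2)
      (K * (p - 2 * (1 - c) / (2 - c) * (M / c))) p := by
  have hdr : HasDerivAt (fun q : ℝ => M - c * q) (-c) p := by
    simpa using ((hasDerivAt_id p).const_mul c).const_sub M
  have hdrp : HasDerivAt (fun q : ℝ => M - c * q + 2 * q) (-c + 2) p := by
    simpa using hdr.fun_add ((hasDerivAt_id p).const_mul 2)
  have heq : (fun q : ℝ => m / (2 * (M - c * q)) *
        (((M - c * q) + √((M - c * q) * ((M - c * q) + 2 * q))) /
          (q + ((M - c * q) + √((M - c * q) * ((M - c * q) + 2 * q))))) ^ 2) =ᶠ[nhds p]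
      fun q => 2 * m / (√(M - c * q) + √(M - c * q + 2 * q)) ^ 2 := by
    filter_upwards [hdr.continuousAt.eventually_const_lt hr,
      hdrp.continuousAt.eventually_const_lt hrp] with q hq hq'
    exact lottoPayoff_eq m hq hq'
  have ha : 0 < √(M - c * p) := Real.sqrt_pos.2 hr
  have hb : 0 < √(M - c * p + 2 * p) := Real.sqrt_pos.2 hrp
  have ha2 : √(M - c * p) ^ 2 = M - c * p := Real.sq_sqrt hr.le
  have hb2 : √(M - c * p + 2 * p) ^ 2 = M - c * p + 2 * p := Real.sq_sqrt hrp.le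
  have hd := (hasDerivAt_const p (2 * m)).div
    (((hdr.sqrt hr.ne').add (hdrp.sqrt hrp.ne')).pow 2) (pow_pos (add_pos ha hb) 2).ne'
  have h2c : 0 < 2 - c := by linarith
  refine ⟨4 * m * (c * (2 - c)) / (√(M - c * p) * √(M - c * p + 2 * p) *
    ((2 - c) * √(M - c * p) + c * √(M - c * p + 2 * p)) *
    (√(M - c * p) + √(M - c * p + 2 * p)) ^ 3), by positivity, ?_⟩
  refine HasDerivAt.congr_of_eventuallyEq (hd.congr_deriv ?_) heq
  simp only [Pi.add_apply, Pi.pow_apply]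
  set a := √(M - c * p)
  set b := √(M - c * p + 2 * p)
  have hcrit : c * (2 - c) * (p - 2 * (1 - c) / (2 - c) * (M / c)) =
      (c * b - (2 - c) * a) * ((2 - c) * a + c * b) / 2 := by
    have : c * (2 - c) * (p - 2 * (1 - c) / (2 - c) * (M / c)) =
        c * (2 - c) * p - 2 * (1 - c) * M := by field_simp
    rw [this]
    linear_combination (2 - c) ^ 2 / 2 * ha2 - c ^ 2 / 2 * hb2
  rw [div_mul_eq_mul_div, mul_assoc (4 * m), hcrit]
  have hs : (2 - c) * a + c * b ≠ 0 := by positivity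
  field_simp
  ring


theorem uB1A_zero_unimodal (cA MA MB : ℝ) (hcA : cA ∈ Set.Ioo (0 : ℝ) 1)
    (hMA : 0 < MA) (hMB : 0 < MB) :
    (∀ p ∈ Set.Ioo 0 (MA / cA),
      (deriv (fun q : ℝ => MB / (2 * (MA - cA * q)) *
        (((MA - cA * q) + Real.sqrt ((MA - cA * q) * ((MA - cA * q) + 2 * q))) /
          (q + ((MA - cA * q) + Real.sqrt ((MA - cA * q) * ((MA - cA * q) + 2 * q))))) ^ 2) p = 0
        ↔ p = 2 * (1 - cA) / (2 - cA) * (MA / cA))) ∧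
    StrictAntiOn
      (fun q : ℝ => MB / (2 * (MA - cA * q)) *
        (((MA - cA * q) + Real.sqrt ((MA - cA * q) * ((MA - cA * q) + 2 * q))) /
          (q + ((MA - cA * q) + Real.sqrt ((MA - cA * q) * ((MA - cA * q) + 2 * q))))) ^ 2)
      (Set.Ico 0 (2 * (1 - cA) / (2 - cA) * (MA / cA))) ∧
    StrictMonoOn
      (fun q : ℝ => MB / (2 * (MA - cA * q)) *
        (((MA - cA * q) + Real.sqrt ((MA - cA * q) * ((MA - cA * q) + 2 * q))) /
          (q + ((MA - cA * q) + Real.sqrt ((MA - cA * q) * ((MA - cA * q) + 2 * q))))) ^ 2)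
      (Set.Ioo (2 * (1 - cA) / (2 - cA) * (MA / cA)) (MA / cA)) := by
  obtain ⟨hc, hc1⟩ := hcA
  have h2c : 0 < 2 - cA := by linarith
  have hcrit_nonneg : 0 ≤ 2 * (1 - cA) / (2 - cA) * (MA / cA) := by
    have : 0 < 1 - cA := by linarith
    positivity
  have hcrit_lt : 2 * (1 - cA) / (2 - cA) * (MA / cA) < MA / cA := by
    refine mul_lt_of_lt_one_left (by positivity) ?_
    rw [div_lt_one h2c]
    linarith
  have key : ∀ p, 0 ≤ p → p < MA / cA → _ := fun p hp hp' => by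
    have hr : 0 < MA - cA * p := by
      rw [lt_div_iff₀ hc] at hp'
      linarith
    exact exists_pos_hasDerivAt_lottoPayoff hc hc1 hMB hr (by linarith)
  refine ⟨fun p hp => ?_, ?_, ?_⟩
  · obtain ⟨K, hK, hd⟩ := key p hp.1.le hp.2
    rw [hd.deriv, mul_eq_zero, sub_eq_zero, or_iff_right hK.ne']
  · refine strictAntiOn_of_deriv_neg (convex_Ico _ _) (fun p hp => ?_) (fun p hp => ?_)
    · obtain ⟨K, hK, hd⟩ := key p hp.1 (hp.2.trans hcrit_lt)
      exact hd.continuousAt.continuousWithinAt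
    · rw [interior_Ico] at hp
      obtain ⟨K, hK, hd⟩ := key p hp.1.le (hp.2.trans hcrit_lt)
      rw [hd.deriv]
      exact mul_neg_of_pos_of_neg hK (sub_neg.2 hp.2)
  · refine strictMonoOn_of_deriv_pos (convex_Ioo _ _) (fun p hp => ?_) (fun p hp => ?_)
    · obtain ⟨K, hK, hd⟩ := key p (hcrit_nonneg.trans hp.1.le) hp.2
      exact hd.continuousAt.continuousWithinAt
    · rw [interior_Ioo] at hp
      obtain ⟨K, hK, hd⟩ := key p (hcrit_nonneg.trans hp.1.le) hp.2
      rw [hd.deriv]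
      exact mul_pos hK (sub_pos.2 hp.1)
end

section
/- Let R_A > 0, p_A > 0, c_B ∈ (0,1), set t_A = R_A + p_A, and suppose c_B·p_A < M_B ≤ c_B·t_A. Then the discriminant (2t_A(2−c_B) − (M_B − c_B·p_A))² − 4(2−c_B)(2t_A(t_A − M_B) + M_B·p_A) is negative if and only if M_B < c_B·p_A − 2(2−c_B)R_A + 2R_A·√(2(2−c_B)); equivalently, the equation 2(t_A − p)²/(2R_A + p_A − p) = M_B − c_B·p has no real solutions p if and only if M_B < c_B·p_A − 2(2−c_B)R_A + 2R_A·√(2(2−c_B)). -/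
/-- A real quadratic with nonzero leading coefficient has no root iff its discriminant is negative. -/
theorem not_exists_quadratic_eq_zero_iff {a b c : ℝ} (ha : a ≠ 0) :
    (¬ ∃ x : ℝ, a * (x * x) + b * x + c = 0) ↔ discrim a b c < 0 := by
  constructor
  · intro h
    by_contra! hd
    exact h (exists_quadratic_eq_zero ha ⟨√(discrim a b c), (Real.mul_self_sqrt hd).symm⟩)
  · rintro h ⟨x, hx⟩
    rw [discrim_eq_sq_of_quadratic_eq_zero hx] at h
    exact absurd h (sq_nonneg _).not_gt


theorem discriminant_negative_iff (RA pA cB MB : ℝ) (hRA : 0 < RA) (hpA : 0 < pA)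
    (hcB : cB ∈ Set.Ioo (0 : ℝ) 1) (h1 : cB * pA < MB) (h2 : MB ≤ cB * (RA + pA)) :
    ((2 * (RA + pA) * (2 - cB) - (MB - cB * pA)) ^ 2
        - 4 * (2 - cB) * (2 * (RA + pA) * ((RA + pA) - MB) + MB * pA) < 0
      ↔ MB < cB * pA - 2 * (2 - cB) * RA + 2 * RA * Real.sqrt (2 * (2 - cB))) ∧
    ((¬ ∃ p : ℝ, 2 * ((RA + pA) - p) ^ 2 / (2 * RA + pA - p) = MB - cB * p)
      ↔ MB < cB * pA - 2 * (2 - cB) * RA + 2 * RA * Real.sqrt (2 * (2 - cB))) := by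
  obtain ⟨hc0, hc1⟩ := hcB
  have hs : √(2 * (2 - cB)) ^ 2 = 2 * (2 - cB) := Real.sq_sqrt (by linarith)
  have hR : 0 < (2 - cB) * RA := mul_pos (by linarith) hRA
  have hdisc : (2 * (RA + pA) * (2 - cB) - (MB - cB * pA)) ^ 2
        - 4 * (2 - cB) * (2 * (RA + pA) * ((RA + pA) - MB) + MB * pA) < 0
      ↔ MB < cB * pA - 2 * (2 - cB) * RA + 2 * RA * √(2 * (2 - cB)) := by
    have hfactor : (2 * (RA + pA) * (2 - cB) - (MB - cB * pA)) ^ 2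
        - 4 * (2 - cB) * (2 * (RA + pA) * ((RA + pA) - MB) + MB * pA)
        = (MB - cB * pA + 2 * (2 - cB) * RA) ^ 2 - (2 * RA * √(2 * (2 - cB))) ^ 2 := by
      rw [mul_pow _ √(2 * (2 - cB)), hs]
      ring
    rw [hfactor, sub_neg, pow_lt_pow_iff_left₀ (by linarith) (by positivity) two_ne_zero]
    constructor <;> intro h <;> linarith
  refine ⟨hdisc, ?_⟩
  have hquad (p : ℝ) : 2 * ((RA + pA) - p) ^ 2 / (2 * RA + pA - p) = MB - cB * p ↔
      (2 - cB) * (p * p) + -(2 * (RA + pA) * (2 - cB) - (MB - cB * pA)) * p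
        + (2 * (RA + pA) * ((RA + pA) - MB) + MB * pA) = 0 := by
    rcases eq_or_ne (2 * RA + pA - p) 0 with hp | hp
    · obtain rfl : p = 2 * RA + pA := by linarith
      rw [hp, div_zero]
      constructor
      · intro h
        nlinarith [mul_pos hc0 hRA]
      · intro h
        nlinarith [pow_pos hRA 2]
    · rw [div_eq_iff hp]
      constructor <;> intro h <;> linear_combination h
  simp_rw [hquad]
  rw [not_exists_quadratic_eq_zero_iff (by linarith), discrim, neg_sq, hdisc]
end

section
/- Let R_A > 0, p_A > 0, c_B ∈ (0,1). Set f₀ = R_A + √(R_A(R_A + 2p_A)), K₁ = c_B(2 − c_B)/2 and K₂ = ((√R_A + √(R_A + 2p_A))/(R_A + p_A + √(R_A(R_A + 2p_A))))². Then there exists a unique value h ∈ (R_A + p_A, p_A + f₀/2) such that, with M_B = c_B·h, the equality (M_B/2)·K₂ = 1 − K₁·R_A/(M_B − c_B·p_A) holds; moreover h = (1/(c_B·K₂))·[(K₂/2)c_B·p_A + 1 − √(((K₂/2)c_B·p_A + 1)² − 2K₂(c_B·p_A + K₁·R_A))]·... specifically, M_B = c_B·h is given by M_B/c_B = (1/(c_B·K₂))·[(K₂/2)c_B·p_A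 + 1 − √(((K₂/2)c_B·p_A + 1)² − 2K₂(c_B·p_A + K₁·R_A))]. -/
/-- Away from the pole at `h = p`, the indifference equation of the two payoffs is a quadratic
equation in `h`. -/
lemma indifference_iff_quadratic {K c p r h : ℝ} (hc : 0 < c) (hh : p < h) :
    c * h / 2 * K = 1 - c * (2 - c) / 2 * r / (c * h - c * p) ↔
      c * K * h ^ 2 - (2 + c * K * p) * h + (2 * p + (2 - c) * r) = 0 := by
  have hd : h - p ≠ 0 := (sub_pos.mpr hh).ne'
  have hfrac : c * (2 - c) / 2 * r / (c * h - c * p) = (2 - c) / 2 * r / (h - p) := by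
    rw [← mul_sub]
    field_simp
  rw [hfrac, eq_sub_iff_add_eq, ← eq_sub_iff_add_eq', div_eq_iff hd]
  exact ⟨fun heq => by linear_combination 2 * heq, fun heq => by linear_combination heq / 2⟩

/-- A root of the quadratic to the left of its vertex is given by the quadratic formula with the
negative sign. -/
lemma eq_smaller_root_of_quadratic {K c p r h : ℝ} (hc : 0 < c) (hK : 0 < K)
    (hroot : c * K * h ^ 2 - (2 + c * K * p) * h + (2 * p + (2 - c) * r) = 0)
    (hvertex : c * K * h ≤ K / 2 * c * p + 1) :
    h = 1 / (c * K) * (K / 2 * c * p + 1 -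
      Real.sqrt ((K / 2 * c * p + 1) ^ 2 - 2 * K * (c * p + c * (2 - c) / 2 * r))) := by
  have hdisc : (K / 2 * c * p + 1) ^ 2 - 2 * K * (c * p + c * (2 - c) / 2 * r) =
      (K / 2 * c * p + 1 - c * K * h) ^ 2 := by
    linear_combination (-(c * K)) * hroot
  rw [hdisc, Real.sqrt_sq (sub_nonneg.mpr hvertex)]
  field_simp
  ring

/-- A continuous function that is positive at the left end and negative at the right end of an
interval has a zero strictly inside. -/
lemma exists_mem_Ioo_eq_zero {f : ℝ → ℝ} {l u : ℝ} (hlu : l ≤ u) (hf : Continuous f)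
    (hl : 0 < f l) (hu : f u < 0) : ∃ x ∈ Set.Ioo l u, f x = 0 :=
  intermediate_value_Ioo' hlu hf.continuousOn ⟨hu, hl⟩


theorem threshold_h_exists_unique (RA pA cB : ℝ) (hRA : 0 < RA) (hpA : 0 < pA)
    (hcB : cB ∈ Set.Ioo (0 : ℝ) 1) :
    (∃! h : ℝ,
      h ∈ Set.Ioo (RA + pA) (pA + (RA + Real.sqrt (RA * (RA + 2 * pA))) / 2) ∧
      cB * h / 2 *
          ((Real.sqrt RA + Real.sqrt (RA + 2 * pA)) /
            (RA + pA + Real.sqrt (RA * (RA + 2 * pA)))) ^ 2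
        = 1 - cB * (2 - cB) / 2 * RA / (cB * h - cB * pA)) ∧
    ∀ h : ℝ,
      h ∈ Set.Ioo (RA + pA) (pA + (RA + Real.sqrt (RA * (RA + 2 * pA))) / 2) →
      cB * h / 2 *
          ((Real.sqrt RA + Real.sqrt (RA + 2 * pA)) /
            (RA + pA + Real.sqrt (RA * (RA + 2 * pA)))) ^ 2
        = 1 - cB * (2 - cB) / 2 * RA / (cB * h - cB * pA) →
      h = 1 / (cB * ((Real.sqrt RA + Real.sqrt (RA + 2 * pA)) /
            (RA + pA + Real.sqrt (RA * (RA + 2 * pA)))) ^ 2) *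
          (((Real.sqrt RA + Real.sqrt (RA + 2 * pA)) /
              (RA + pA + Real.sqrt (RA * (RA + 2 * pA)))) ^ 2 / 2 * cB * pA + 1
            - Real.sqrt ((((Real.sqrt RA + Real.sqrt (RA + 2 * pA)) /
                  (RA + pA + Real.sqrt (RA * (RA + 2 * pA)))) ^ 2 / 2 * cB * pA + 1) ^ 2
                - 2 * ((Real.sqrt RA + Real.sqrt (RA + 2 * pA)) /
                    (RA + pA + Real.sqrt (RA * (RA + 2 * pA)))) ^ 2 *
                  (cB * pA + cB * (2 - cB) / 2 * RA))) := by
  obtain ⟨hc0, hc1⟩ := hcB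
  set a := Real.sqrt RA with ha
  set b := Real.sqrt (RA + 2 * pA) with hb
  have ha0 : 0 < a := Real.sqrt_pos.mpr hRA
  have hab : a < b := Real.sqrt_lt_sqrt hRA.le (by linarith)
  have hRA' : RA = a ^ 2 := (Real.sq_sqrt hRA.le).symm
  have hpA' : pA = (b ^ 2 - a ^ 2) / 2 := by
    have hbsq : b ^ 2 = RA + 2 * pA := Real.sq_sqrt (by positivity)
    linarith
  rw [Real.sqrt_mul hRA.le, ← ha, ← hb]
  have hs : 0 < a + b := by linarith
  have hK2 : ((a + b) / (RA + pA + a * b)) ^ 2 = 4 / (a + b) ^ 2 := by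
    have hden : RA + pA + a * b = (a + b) ^ 2 / 2 := by rw [hRA', hpA']; ring
    rw [hden]
    field_simp
    norm_num
  rw [hK2]
  set K := 4 / (a + b) ^ 2 with hK
  have hK0 : 0 < K := by positivity
  have hKs : K * (a + b) ^ 2 = 4 := by rw [hK]; field_simp
  have hformula : ∀ h ∈ Set.Ioo (RA + pA) (pA + (RA + a * b) / 2),
      cB * h / 2 * K = 1 - cB * (2 - cB) / 2 * RA / (cB * h - cB * pA) →
      h = 1 / (cB * K) * (K / 2 * cB * pA + 1 - Real.sqrt ((K / 2 * cB * pA + 1) ^ 2 -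
        2 * K * (cB * pA + cB * (2 - cB) / 2 * RA))) := by
    rintro h ⟨hl, hu⟩ heq
    refine eq_smaller_root_of_quadratic hc0 hK0
      ((indifference_iff_quadratic hc0 (by linarith)).mp heq) ?_
    have hlt : K * (h - pA / 2) ≤ K * ((a + b) ^ 2 / 4) := by
      refine mul_le_mul_of_nonneg_left ?_ hK0.le
      linarith [hRA', hpA']
    have hle : cB * (K * (h - pA / 2)) ≤ cB * 1 :=
      mul_le_mul_of_nonneg_left (by linarith) hc0.le
    linarith
  refine ⟨?_, hformula⟩
  obtain ⟨h, hmem, hroot⟩ := exists_mem_Ioo_eq_zero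
    (f := fun h => cB * K * h ^ 2 - (2 + cB * K * pA) * h + (2 * pA + (2 - cB) * RA))
    (l := RA + pA) (u := pA + (RA + a * b) / 2)
    (by rw [hRA']; nlinarith) (by fun_prop)
    (by
      have hval : cB * K * (RA + pA) ^ 2 - (2 + cB * K * pA) * (RA + pA) +
          (2 * pA + (2 - cB) * RA) = cB * a ^ 2 * K * (b - a) ^ 2 / 4 := by
        rw [hRA', hpA']
        linear_combination (cB * a ^ 2 / 4) * hKs
      have hba : 0 < b - a := sub_pos.mpr hab
      simp only [hval]
      positivity)
    (by
      have hval : cB * K * (pA + (RA + a * b) / 2) ^ 2 -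
          (2 + cB * K * pA) * (pA + (RA + a * b) / 2) +
          (2 * pA + (2 - cB) * RA) = -((1 - cB) * (a * (b - a))) := by
        rw [hRA', hpA']
        linear_combination (cB * a * b / 4) * hKs
      simp only [hval]
      exact neg_neg_of_pos
        (mul_pos (sub_pos.mpr hc1) (mul_pos ha0 (sub_pos.mpr hab))))
  have heq := (indifference_iff_quadratic hc0 (by linarith [hmem.1])).mpr hroot
  exact ⟨h, ⟨hmem, heq⟩, fun y hy =>
    (hformula y hy.1 hy.2).trans (hformula h hmem heq).symm⟩
end

section
/- Let W₁, W₂, s > 0 and C₁, C₂ > 0 with H₁ := C₁² − W₁·s > 0, and set H₂ := C₂² + W₂·s and D := W₁·C₂² + W₂·C₁². Then κ_B := (C₁·H₂ + C₂·√(H₁·H₂))/D and κ_A := (C₂·H₁ + C₁·√(H₁·H₂))/D satisfy the system of equations W₁·κ_B² + W₂·κ_A² = 2κ_B·C₁ − s and W₁·κ_B² + W₂·κ_A² = 2κ_A·C₂ + s. -/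
theorem kappa_solution_satisfies_system (W1 W2 s C1 C2 : ℝ) (hW1 : 0 < W1) (hW2 : 0 < W2)
    (hs : 0 < s) (hC1 : 0 < C1) (hC2 : 0 < C2) (hH1 : 0 < C1 ^ 2 - W1 * s) :
    W1 * ((C1 * (C2 ^ 2 + W2 * s) +
            C2 * Real.sqrt ((C1 ^ 2 - W1 * s) * (C2 ^ 2 + W2 * s))) /
          (W1 * C2 ^ 2 + W2 * C1 ^ 2)) ^ 2 +
      W2 * ((C2 * (C1 ^ 2 - W1 * s) +
            C1 * Real.sqrt ((C1 ^ 2 - W1 * s) * (C2 ^ 2 + W2 * s))) /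
          (W1 * C2 ^ 2 + W2 * C1 ^ 2)) ^ 2
      = 2 * ((C1 * (C2 ^ 2 + W2 * s) +
            C2 * Real.sqrt ((C1 ^ 2 - W1 * s) * (C2 ^ 2 + W2 * s))) /
          (W1 * C2 ^ 2 + W2 * C1 ^ 2)) * C1 - s ∧
    W1 * ((C1 * (C2 ^ 2 + W2 * s) +
            C2 * Real.sqrt ((C1 ^ 2 - W1 * s) * (C2 ^ 2 + W2 * s))) /
          (W1 * C2 ^ 2 + W2 * C1 ^ 2)) ^ 2 +
      W2 * ((C2 * (C1 ^ 2 - W1 * s) +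
            C1 * Real.sqrt ((C1 ^ 2 - W1 * s) * (C2 ^ 2 + W2 * s))) /
          (W1 * C2 ^ 2 + W2 * C1 ^ 2)) ^ 2
      = 2 * ((C2 * (C1 ^ 2 - W1 * s) +
            C1 * Real.sqrt ((C1 ^ 2 - W1 * s) * (C2 ^ 2 + W2 * s))) /
          (W1 * C2 ^ 2 + W2 * C1 ^ 2)) * C2 + s := by
  have hQ : 0 ≤ (C1 ^ 2 - W1 * s) * (C2 ^ 2 + W2 * s) := by positivity
  have hq := Real.sq_sqrt hQ
  have hD : W1 * C2 ^ 2 + W2 * C1 ^ 2 ≠ 0 := by positivity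
  generalize Real.sqrt ((C1 ^ 2 - W1 * s) * (C2 ^ 2 + W2 * s)) = q at hq ⊢
  constructor <;> field_simp <;> linear_combination (W1 * C2 ^ 2 + W2 * C1 ^ 2) * hq
end
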